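/- Let Q be a quadratic form on ⋀²ℂ⁵ such that Q(v ∧ w) = 0 for all v, w ∈ ℂ⁵, i.e. Q vanishes on every decomposable element of ⋀²ℂ⁵. Then the polar form of Q, polar Q(ω, η) = Q(ω + η) − Q(ω) − Q(η), is degenerate: there exists a nonzero ω ∈ ⋀²ℂ⁵ with polar Q(ω, η) = 0 for all η ∈ ⋀²ℂ⁵. (Equivalently: no smooth quadric hypersurface in ℙ⁹ contains the Plücker-embedded Grassmannian 𝔾(1,4); this is the fact used in Section 3 of the paper to rule out the case c = r − 1 with r = 4, namely that a smooth 8-dimensional quadric cannot contain 𝔾(1,4).) -/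

import Mathlib

open ExteriorAlgebra

/-- The element `v ∧ w` of `⋀²ℂ⁵`, as an element of the second exterior power
(a submodule of the exterior algebra of `ℂ⁵`). -/
noncomputable def wedgeDec (v w : Fin 5 → ℂ) : ⋀[ℂ]^2 (Fin 5 → ℂ) :=
  ⟨ι ℂ v * ι ℂ w, by
    have h := Submodule.mul_mem_mul (LinearMap.mem_range_self (ι ℂ) v)
      (LinearMap.mem_range_self (ι ℂ) w)
    rwa [← pow_two] at h⟩

/-- The wedge product `(v, w) ↦ v ∧ w` as a bilinear map. -/
noncomputable def wedgeBilin :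
    (Fin 5 → ℂ) →ₗ[ℂ] (Fin 5 → ℂ) →ₗ[ℂ] ⋀[ℂ]^2 (Fin 5 → ℂ) :=
  LinearMap.mk₂ ℂ wedgeDec
    (fun _ _ _ => Subtype.ext (by simp [wedgeDec, add_mul]))
    (fun _ _ _ => Subtype.ext (by simp [wedgeDec]))
    (fun _ _ _ => Subtype.ext (by simp [wedgeDec, mul_add]))
    (fun _ _ _ => Subtype.ext (by simp [wedgeDec]))

theorem wedgeBilin_apply (v w : Fin 5 → ℂ) : wedgeBilin v w = wedgeDec v w := rfl

theorem wedgeBilin_swap (v w : Fin 5 → ℂ) : wedgeBilin v w = -wedgeBilin w v :=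
  Subtype.ext (eq_neg_of_add_eq_zero_left (ι_add_mul_swap v w))

theorem span_range_wedgeBilin :
    Submodule.span ℂ (Set.range fun p : (Fin 5 → ℂ) × (Fin 5 → ℂ) => wedgeBilin p.1 p.2) = ⊤ := by
  rw [eq_top_iff, ← exteriorPower.ιMulti_span ℂ 2 (Fin 5 → ℂ), Submodule.span_le]
  rintro _ ⟨a, rfl⟩
  refine Submodule.subset_span ⟨(a 0, a 1), Subtype.ext ?_⟩
  simp [wedgeBilin_apply, wedgeDec, ExteriorAlgebra.ιMulti_apply, Matrix.vecTail]

theorem exists_wedgeBilin_ne_zero {a : Fin 5 → ℂ} (ha : a ≠ 0) : ∃ v, wedgeBilin a v ≠ 0 := by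
  obtain ⟨i, hi⟩ := Function.ne_iff.mp ha
  obtain ⟨j, hj⟩ := exists_ne i
  refine ⟨Pi.single j 1, fun h => ?_⟩
  have h' : ι ℂ a * ι ℂ (Pi.single j (1 : ℂ) : Fin 5 → ℂ) = 0 := congrArg Subtype.val h
  have h'' := congrArg
    (CliffordAlgebra.contractLeft (LinearMap.proj i : (Fin 5 → ℂ) →ₗ[ℂ] ℂ)) h'
  erw [CliffordAlgebra.contractLeft_ι_mul, CliffordAlgebra.contractLeft_ι] at h''
  simp only [LinearMap.proj_apply, Pi.single_apply, hj.symm, if_false, map_zero, mul_zero,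
    sub_zero, smul_eq_zero] at h''
  rcases h'' with h'' | h''
  · exact hi h''
  · have := congrFun ((ExteriorAlgebra.ι_inj ℂ _ 0).mp (h''.trans (map_zero _).symm)) j
    simp at this

/-- An alternating array of degree three vanishes if its entries at increasing indices do. -/
theorem eq_zero_of_alternating {ι : Type*} [LinearOrder ι] (F : ι → ι → ι → ℂ)
    (h₁ : ∀ j k l, F j k l = -F k j l) (h₂ : ∀ j k l, F j k l = -F j l k)
    (hF : ∀ j k l, j < k → k < l → F j k l = 0) (j k l : ι) : F j k l = 0 := by
  have hz₁ : ∀ j l, F j j l = 0 := fun j l => by linear_combination h₁ j j l / 2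
  have hz₂ : ∀ j l, F j l l = 0 := fun j l => by linear_combination h₂ j l l / 2
  rcases lt_trichotomy j k with h | h | h <;> rcases lt_trichotomy k l with h' | h' | h' <;>
    rcases lt_trichotomy j l with h'' | h'' | h'' <;> grind

/-- An alternating array of degree four on five indices has a nonzero vector in its kernel. -/
theorem exists_ne_zero_sum_mul_eq_zero (t : Fin 5 → Fin 5 → Fin 5 → Fin 5 → ℂ)
    (h₁ : ∀ i j k l, t i j k l = -t j i k l)
    (h₂ : ∀ i j k l, t i j k l = -t i k j l)
    (h₃ : ∀ i j k l, t i j k l = -t i j l k) :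
    ∃ a : Fin 5 → ℂ, a ≠ 0 ∧ ∀ j k l, ∑ m, a m * t m j k l = 0 := by
  have d₁ : ∀ i k l, t i i k l = 0 := fun i k l => by linear_combination h₁ i i k l / 2
  have d₂ : ∀ i k l, t i k i l = 0 := fun i k l => by rw [h₂, d₁, neg_zero]
  have d₃ : ∀ i k l, t i k l i = 0 := fun i k l => by rw [h₃, d₂, neg_zero]
  by_cases hc : (![t 1 2 3 4, -t 0 2 3 4, t 0 1 3 4, -t 0 1 2 4, t 0 1 2 3] : Fin 5 → ℂ) = 0
  · refine ⟨Pi.single 0 1, fun h => by simpa using congrFun h 0, fun j k l => ?_⟩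
    simp only [Pi.single_apply, ite_mul, one_mul, zero_mul, Finset.sum_ite_eq', Finset.mem_univ,
      if_true]
    refine eq_zero_of_alternating (t 0) (h₂ 0) (h₃ 0) (fun j k l hjk hkl => ?_) j k l
    have e₁ : t 0 2 3 4 = 0 := by simpa using congrFun hc 1
    have e₂ : t 0 1 3 4 = 0 := by simpa using congrFun hc 2
    have e₃ : t 0 1 2 4 = 0 := by simpa using congrFun hc 3
    have e₄ : t 0 1 2 3 = 0 := by simpa using congrFun hc 4
    fin_cases j <;> fin_cases k <;> first | exact absurd hjk (by decide) | skip
    all_goals fin_cases l <;> first | exact absurd hkl (by decide) | skip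
    all_goals simp [d₁, e₁, e₂, e₃, e₄]
  · refine ⟨_, hc, eq_zero_of_alternating _ (fun j k l => ?_) (fun j k l => ?_)
      fun j k l hjk hkl => ?_⟩
    · rw [← Finset.sum_neg_distrib]
      exact Finset.sum_congr rfl fun m _ => by rw [h₂ m]; ring
    · rw [← Finset.sum_neg_distrib]
      exact Finset.sum_congr rfl fun m _ => by rw [h₃ m]; ring
    · fin_cases j <;> fin_cases k <;> first | exact absurd hjk (by decide) | skip
      all_goals fin_cases l <;> first | exact absurd hkl (by decide) | skip
      all_goals simp [Fin.sum_univ_five, d₁, d₂, d₃]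
      all_goals grind

/-- A quadratic form on `⋀²ℂ⁵` vanishing on all decomposable elements `v ∧ w` (i.e. a
quadric of `ℙ⁹` containing the Plücker-embedded Grassmannian `𝔾(1,4)`) is degenerate:
some nonzero vector pairs to zero with every vector under the polar form of `Q`.
Equivalently, no smooth quadric hypersurface of `ℙ⁹` contains `𝔾(1,4)`. -/
theorem quadric_through_grassmannian_degenerate
    (Q : QuadraticForm ℂ (⋀[ℂ]^2 (Fin 5 → ℂ)))
    (hQ : ∀ v w : Fin 5 → ℂ, Q (wedgeDec v w) = 0) :
    ∃ ω : ⋀[ℂ]^2 (Fin 5 → ℂ), ω ≠ 0 ∧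
      ∀ η : ⋀[ℂ]^2 (Fin 5 → ℂ), QuadraticMap.polar Q ω η = 0 := by
  have hB : ∀ x y z, Q.polarBilin (wedgeBilin x y) (wedgeBilin x z) = 0 := fun x y z => by
    simp only [QuadraticMap.polarBilin_apply_apply, QuadraticMap.polar, ← map_add]
    simp only [wedgeBilin_apply, hQ, sub_zero]
  have hswap : ∀ x y z w, Q.polarBilin (wedgeBilin x y) (wedgeBilin z w) =
      -Q.polarBilin (wedgeBilin x z) (wedgeBilin y w) := fun x y z w => by
    have h := hB (y + z) x w
    simp only [map_add, LinearMap.add_apply, hB, zero_add, add_zero] at h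
    rw [wedgeBilin_swap x y, wedgeBilin_swap x z]
    simp only [map_neg, LinearMap.neg_apply]
    linear_combination -h
  let e : Fin 5 → Fin 5 → ℂ := fun i => Pi.single i 1
  let t : Fin 5 → Fin 5 → Fin 5 → Fin 5 → ℂ := fun i j k l =>
    Q.polarBilin (wedgeBilin (e i) (e j)) (wedgeBilin (e k) (e l))
  have h₁ : ∀ i j k l, t i j k l = -t j i k l := fun i j k l => by
    simp only [t]; rw [wedgeBilin_swap]; simp only [map_neg, LinearMap.neg_apply]
  have h₂ : ∀ i j k l, t i j k l = -t i k j l := fun i j k l => hswap _ _ _ _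
  have h₃ : ∀ i j k l, t i j k l = -t i j l k := fun i j k l => by
    simp only [t]; rw [wedgeBilin_swap (e k)]; simp only [map_neg]
  obtain ⟨a, ha, hat⟩ := exists_ne_zero_sum_mul_eq_zero t h₁ h₂ h₃
  obtain ⟨v, hv⟩ := exists_wedgeBilin_ne_zero ha
  have hexp : ∀ x : Fin 5 → ℂ, x = ∑ i, x i • e i := fun x => by
    simpa [e] using pi_eq_sum_univ' x
  refine ⟨wedgeBilin a v, hv, fun η => ?_⟩
  suffices h : Q.polarBilin (wedgeBilin a v) = 0 from LinearMap.congr_fun h η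
  refine LinearMap.ext_on_range span_range_wedgeBilin ?_
  rintro ⟨x, y⟩
  simp only [LinearMap.zero_apply]
  have h4 : ∀ j k l, Q.polarBilin (wedgeBilin a (e j)) (wedgeBilin (e k) (e l)) = 0 :=
    fun j k l => by
      rw [hexp a, ← hat j k l]
      simp [t, LinearMap.sum_apply]
  rw [hexp v, hexp x, hexp y]
  simp only [map_sum, map_smul, LinearMap.sum_apply, LinearMap.smul_apply, h4, smul_zero,
    Finset.sum_const_zero]
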